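/- There does not exist a pair of orthogonal Latin squares of order 6. -/

import Mathlib

/-- A Latin square of order `d` with entries in `{1, …, d}` (as natural numbers): every
entry lies in `{1, …, d}`, and every symbol occurs exactly once in each row and column. -/
def IsLatinSquare (d : ℕ) (M : Fin d → Fin d → ℕ) : Prop :=
  (∀ i j, 1 ≤ M i j ∧ M i j ≤ d) ∧
  (∀ i, Function.Injective (M i)) ∧
  (∀ j, Function.Injective fun i => M i j)

/-- Two Latin squares of order `d` are orthogonal if the `d²` ordered pairs of corresponding
entries are pairwise distinct. -/
def OrthogonalPair (d : ℕ) (L M : Fin d → Fin d → ℕ) : Prop :=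
  Function.Injective fun x : Fin d × Fin d => (L x.1 x.2, M x.1 x.2)

/-- Backtracking search over blocks. -/
def bsearch {α : Type} (compat : α → α → Bool) : List (List α) → List α → Bool
  | [], _ => true
  | cands :: rest, placed =>
    cands.any fun b => placed.all (compat b) && bsearch compat rest (b :: placed)

theorem bsearch_sound {α : Type} (compat : α → α → Bool) (Sol : α → Prop)
    (hc : ∀ a b, Sol a → Sol b → compat a b = true) (cells : List (List α)) :
    ∀ placed : List α, (∀ c ∈ cells, ∃ y ∈ c, Sol y) → (∀ b ∈ placed, Sol b) →
      bsearch compat cells placed = true := by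
  induction cells with
  | nil => intro placed _ _; rfl
  | cons c rest ih =>
    intro placed h1 h2
    obtain ⟨y, hy, hs⟩ := h1 c (by simp)
    simp only [bsearch, List.any_eq_true, Bool.and_eq_true, List.all_eq_true]
    refine ⟨y, hy, fun b hb => hc y b hs (h2 b hb), ih _ (fun c' h' => h1 c' (by simp [h'])) ?_⟩
    intro b hb
    rcases List.mem_cons.1 hb with rfl | hb
    · exact hs
    · exact h2 b hb

/-- Two blocks sharing two points agree. -/
def compatQ : ℕ × ℕ × ℕ × ℕ → ℕ × ℕ × ℕ × ℕ → Bool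
  | (r, c, l, m), (r₂, c₂, l₂, m₂) =>
    (!(Nat.beq r r₂) || ((!(Nat.beq l l₂) || Nat.beq c c₂) && (!(Nat.beq m m₂) || Nat.beq c c₂))) &&
    (!(Nat.beq c c₂) || ((!(Nat.beq l l₂) || Nat.beq r r₂) && (!(Nat.beq m m₂) || Nat.beq r r₂))) &&
    (!(Nat.beq l l₂) || !(Nat.beq m m₂) || Nat.beq r r₂)

theorem compatQ_of (r c l m r₂ c₂ l₂ m₂ : ℕ) (k1 : r = r₂ → l = l₂ → c = c₂)
    (k2 : r = r₂ → m = m₂ → c = c₂) (k3 : c = c₂ → l = l₂ → r = r₂)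
    (k4 : c = c₂ → m = m₂ → r = r₂) (k5 : l = l₂ → m = m₂ → r = r₂) :
    compatQ (r, c, l, m) (r₂, c₂, l₂, m₂) = true := by
  have hb : ∀ a b : ℕ, Nat.beq a b = decide (a = b) := fun a b => by
    by_cases h : a = b
    · subst h; simp
    · rw [decide_eq_false h]; exact Bool.eq_false_iff.2 fun e => h (Nat.eq_of_beq_eq_true e)
  simp only [compatQ, hb]
  by_cases h1 : r = r₂ <;> by_cases h2 : c = c₂ <;> by_cases h3 : l = l₂ <;>
    by_cases h4 : m = m₂ <;> simp_all

/-- Number of coordinates below two. -/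
def smallCount (r c l m : ℕ) : ℕ :=
  (Nat.ble r 1).toNat + (Nat.ble c 1).toNat + (Nat.ble l 1).toNat + (Nat.ble m 1).toNat

/-- Candidate blocks of a cell. -/
def freeCell (rc : ℕ × ℕ) : List (ℕ × ℕ × ℕ × ℕ) :=
  ((List.range 6).flatMap fun l => (List.range 6).map fun m => (rc.1, rc.2, l, m)).filter
    fun q => Nat.beq (smallCount q.1 q.2.1 q.2.2.1 q.2.2.2) 0 ||
      Nat.beq (smallCount q.1 q.2.1 q.2.2.1 q.2.2.2) 2

/-- The normalised blocks. -/
def fixedCells : List (List (ℕ × ℕ × ℕ × ℕ)) :=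
  [[(0,0,2,2)], [(0,1,3,3)], [(1,0,4,4)], [(1,1,5,5)],
   [(2,2,0,0)], [(3,3,0,1)], [(4,4,1,0)], [(5,5,1,1)]]

/-- The other cells, in search order. -/
def otherCells : List (ℕ × ℕ) :=
  [(0,2),(0,3),(0,4),(0,5),(1,2),(1,3),(1,4),(1,5),
   (2,0),(3,0),(4,0),(5,0),(2,1),(3,1),(4,1),(5,1),
   (2,3),(2,4),(2,5),(3,2),(3,4),(3,5),(4,2),(4,3),(4,5),(5,2),(5,3),(5,4)]

theorem bsearch_fails : bsearch compatQ (fixedCells ++ otherCells.map freeCell) [] = false := by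
  decide +kernel

theorem even_split : ∀ w : Fin 6 → ZMod 2, ∑ a, w a = 0 → (∃ a b, w a ≠ w b) →
    ∃ c x y, x ≠ y ∧ ∀ a, w a = if a = x ∨ a = y then c + 1 else c := by
  decide +kernel

theorem swap_pair : ∀ x y a : Fin 6, x ≠ y →
    (((Equiv.swap 1 (Equiv.swap 0 x y) * Equiv.swap 0 x) a).val < 2 ↔ a = x ∨ a = y) := by
  decide +kernel

/-- Any two of the four coordinate functions determine a block uniquely. -/
def IsTD (p : Fin 4 → Fin 6 × Fin 6 → Fin 6) : Prop :=
  ∀ i j, i ≠ j → Function.Bijective fun x => (p i x, p j x)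

theorem IsTD.sum_pair {p : Fin 4 → Fin 6 × Fin 6 → Fin 6} (hp : IsTD p) {R : Type*} [CommRing R]
    {i j : Fin 4} (hij : i ≠ j) (f g : Fin 6 → R) :
    ∑ x, f (p i x) * g (p j x) = (∑ a, f a) * ∑ b, g b := by
  rw [Finset.sum_mul_sum, ← Finset.sum_product', Finset.univ_product_univ]
  exact Function.Bijective.sum_comp (hp i j hij) (fun y : Fin 6 × Fin 6 => f y.1 * g y.2)

theorem IsTD.sum_one {p : Fin 4 → Fin 6 × Fin 6 → Fin 6} (hp : IsTD p) {R : Type*} [CommRing R]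
    (i : Fin 4) (f : Fin 6 → R) :
    ∑ x, f (p i x) = 6 * ∑ a, f a := by
  obtain ⟨j, hj⟩ : ∃ j, i ≠ j := by
    fin_cases i
    · exact ⟨1, by decide⟩
    all_goals exact ⟨0, by decide⟩
  have := hp.sum_pair hj f (fun _ => 1)
  simp only [mul_one] at this
  rw [this]; simp [mul_comm]

/-- Incidence matrix. -/
def incMat (p : Fin 4 → Fin 6 × Fin 6 → Fin 6) :
    Matrix (Fin 6 × Fin 6) (Fin 4 × Fin 6) (ZMod 2) :=
  Matrix.of fun x q => if p q.1 x = q.2 then 1 else 0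

theorem gram_eq {p : Fin 4 → Fin 6 × Fin 6 → Fin 6} (hp : IsTD p) :
    (incMat p).transpose * incMat p =
      Matrix.of fun q q' : Fin 4 × Fin 6 => if q.1 = q'.1 then (0 : ZMod 2) else 1 := by
  ext ⟨i, a⟩ ⟨j, b⟩
  simp only [Matrix.mul_apply, Matrix.transpose_apply, incMat, Matrix.of_apply]
  by_cases hij : i = j
  · subst hij
    have := hp.sum_one (R := ZMod 2) i
      (fun c => (if c = a then (1 : ZMod 2) else 0) * (if c = b then 1 else 0))
    rw [this]
    have h6 : (6 : ZMod 2) = 0 := by decide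
    simp [h6]
  · have := hp.sum_pair (R := ZMod 2) hij
      (fun c => (if c = a then (1 : ZMod 2) else 0)) (fun c => (if c = b then 1 else 0))
    rw [this]
    simp [hij]

theorem gram_rank {p : Fin 4 → Fin 6 × Fin 6 → Fin 6} (hp : IsTD p) :
    ((incMat p).transpose * incMat p).rank ≤ 4 := by
  have : (incMat p).transpose * incMat p =
      (Matrix.of fun (q : Fin 4 × Fin 6) (k : Fin 4) => if q.1 = k then (0 : ZMod 2) else 1) *
      (Matrix.of fun (k : Fin 4) (q : Fin 4 × Fin 6) => if k = q.1 then (1 : ZMod 2) else 0) := by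
    rw [gram_eq hp]
    ext ⟨i, a⟩ ⟨j, b⟩
    simp [Matrix.mul_apply]
  rw [this]
  refine (Matrix.rank_mul_le_left _ _).trans ?_
  simpa using Matrix.rank_le_card_width
    (Matrix.of fun (q : Fin 4 × Fin 6) (k : Fin 4) => if q.1 = k then (0 : ZMod 2) else 1)

theorem inc_rank {p : Fin 4 → Fin 6 × Fin 6 → Fin 6} (hp : IsTD p) : (incMat p).rank ≤ 20 := by
  set N := incMat p
  have hG : (N.transpose * N).rank ≤ 4 := gram_rank hp
  have hT : N.transpose.rank = N.rank := Matrix.rank_transpose N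
  set g := N.transpose.mulVecLin with hg
  set f := N.mulVecLin with hf
  have h1 : Module.finrank (ZMod 2) (LinearMap.range (g.domRestrict (LinearMap.range f))) +
      Module.finrank (ZMod 2) (LinearMap.ker (g.domRestrict (LinearMap.range f))) = N.rank :=
    LinearMap.finrank_range_add_finrank_ker _
  have h2 : LinearMap.range (g.domRestrict (LinearMap.range f)) =
      LinearMap.range (N.transpose * N).mulVecLin := by
    rw [Matrix.mulVecLin_mul]
    ext y
    simp [LinearMap.mem_range, hf, hg]
  have h3 : Module.finrank (ZMod 2) (LinearMap.range g) +
      Module.finrank (ZMod 2) (LinearMap.ker g) = 36 := by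
    rw [LinearMap.finrank_range_add_finrank_ker]; simp
  have h4 : Module.finrank (ZMod 2) (LinearMap.ker (g.domRestrict (LinearMap.range f))) ≤
      Module.finrank (ZMod 2) (LinearMap.ker g) := by
    rw [LinearMap.ker_domRestrict]
    rw [← LinearMap.finrank_range_of_inj (f := (LinearMap.range f).subtype.domRestrict
      (Submodule.comap (LinearMap.range f).subtype (LinearMap.ker g)))]
    · apply Submodule.finrank_mono
      rintro _ ⟨x, rfl⟩
      exact x.2
    · intro x y h
      exact Subtype.ext (Subtype.ext h)
  rw [h2] at h1
  change (N.transpose * N).rank + _ = _ at h1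
  change N.transpose.rank + _ = _ at h3
  omega

theorem exists_code {p : Fin 4 → Fin 6 × Fin 6 → Fin 6} (hp : IsTD p) :
    ∃ v : Fin 4 × Fin 6 → ZMod 2, (incMat p).mulVec v = 0 ∧ ∃ i a b, v (i, a) ≠ v (i, b) := by
  by_contra hcon
  push Not at hcon
  have h1 : Module.finrank (ZMod 2) (LinearMap.range (incMat p).mulVecLin) +
      Module.finrank (ZMod 2) (LinearMap.ker (incMat p).mulVecLin) = 24 := by
    rw [LinearMap.finrank_range_add_finrank_ker]; simp
  have h2 : Module.finrank (ZMod 2) (LinearMap.range (incMat p).mulVecLin) ≤ 20 := inc_rank hp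
  let φ : (Fin 4 × Fin 6 → ZMod 2) →ₗ[ZMod 2] (Fin 3 → ZMod 2) :=
    LinearMap.pi fun k => LinearMap.proj (k.castSucc, 0)
  have hinj : Function.Injective (φ.domRestrict (LinearMap.ker (incMat p).mulVecLin)) := by
    rw [← LinearMap.ker_eq_bot, LinearMap.ker_eq_bot']
    rintro ⟨v, hv⟩ h
    have hv' : (incMat p).mulVec v = 0 := by simpa using hv
    have hc := hcon v hv'
    have hk : ∀ k : Fin 3, v (k.castSucc, 0) = 0 := fun k => congrFun h k
    have h0 := hk 0
    have h1 := hk 1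
    have h2 := hk 2
    have hx := congrFun hv' (0, 0)
    simp [Matrix.mulVec, dotProduct, incMat, Fintype.sum_prod_type, Fin.sum_univ_four] at hx
    rw [hc 0 _ 0, hc 1 _ 0, hc 2 _ 0, hc 3 _ 0] at hx
    simp at h0 h1 h2
    rw [h0, h1, h2] at hx
    simp at hx
    apply Subtype.ext
    funext ⟨i, a⟩
    change v (i, a) = 0
    rw [hc i a 0]
    fin_cases i <;> assumption
  have h3 := LinearMap.finrank_le_finrank_of_injective hinj
  simp only [Module.finrank_fin_fun] at h3
  omega

theorem code_sum {p : Fin 4 → Fin 6 × Fin 6 → Fin 6} (v : Fin 4 × Fin 6 → ZMod 2)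
    (hv : (incMat p).mulVec v = 0) (x : Fin 6 × Fin 6) :
    v (0, p 0 x) + v (1, p 1 x) + v (2, p 2 x) + v (3, p 3 x) = 0 := by
  have hx := congrFun hv x
  simpa [Matrix.mulVec, dotProduct, incMat, Fintype.sum_prod_type, Fin.sum_univ_four] using hx

theorem code_even {p : Fin 4 → Fin 6 × Fin 6 → Fin 6} (hp : IsTD p) (v : Fin 4 × Fin 6 → ZMod 2)
    (hv : (incMat p).mulVec v = 0) (i : Fin 4) : ∑ a, v (i, a) = 0 := by
  have hG : ((incMat p).transpose * incMat p).mulVec v = 0 := by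
    rw [← Matrix.mulVec_mulVec, hv, Matrix.mulVec_zero]
  rw [gram_eq hp] at hG
  have h : ∀ j : Fin 4, _ := fun j => congrFun hG (j, 0)
  simp only [Matrix.mulVec, dotProduct, Matrix.of_apply, Fintype.sum_prod_type,
    Fin.sum_univ_four, ite_mul, zero_mul, one_mul, Pi.zero_apply] at h
  have h0 := h 0
  have h1 := h 1
  have h2 := h 2
  have h3 := h 3
  simp at h0 h1 h2 h3
  generalize hs0 : ∑ a, v (0, a) = s0 at *
  generalize hs1 : ∑ a, v (1, a) = s1 at *
  generalize hs2 : ∑ a, v (2, a) = s2 at *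
  generalize hs3 : ∑ a, v (3, a) = s3 at *
  have key : ∀ a b c d : ZMod 2, b + c + d = 0 → a + c + d = 0 → a + b + d = 0 → a + b + c = 0 →
      a = 0 ∧ b = 0 ∧ c = 0 ∧ d = 0 := by decide
  obtain ⟨k0, k1, k2, k3⟩ := key _ _ _ _ h0 h1 h2 h3
  fin_cases i
  · exact hs0.trans k0
  · exact hs1.trans k1
  · exact hs2.trans k2
  · exact hs3.trans k3

theorem signs_total : ∀ w : Fin 6 → ZMod 2, ∑ a, w a = 0 →
    ((∃ a b, w a ≠ w b) ↔ (∑ a, (if w a = 0 then (1 : ℤ) else -1) = 2 ∨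
      ∑ a, (if w a = 0 then (1 : ℤ) else -1) = -2)) ∧
    ((∑ a, (if w a = 0 then (1 : ℤ) else -1) = 2 ∨
      ∑ a, (if w a = 0 then (1 : ℤ) else -1) = -2) ∨
    (∑ a, (if w a = 0 then (1 : ℤ) else -1) = 6 ∨
      ∑ a, (if w a = 0 then (1 : ℤ) else -1) = -6)) := by
  decide +kernel

theorem sign_sum_pair : ∀ c : ZMod 2, ∀ x y : Fin 6, x ≠ y →
    ∑ a, (if (if a = x ∨ a = y then c + 1 else c) = 0 then (1 : ℤ) else -1) =
      if c = 0 then 2 else -2 := by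
  decide +kernel

theorem sums_two (A B C D : ℤ)
    (hA : (A = 2 ∨ A = -2) ∨ (A = 6 ∨ A = -6)) (hB : (B = 2 ∨ B = -2) ∨ (B = 6 ∨ B = -6))
    (hC : (C = 2 ∨ C = -2) ∨ (C = 6 ∨ C = -6)) (_hD : (D = 2 ∨ D = -2) ∨ (D = 6 ∨ D = -6))
    (h1 : A * B = C * D) (h2 : A * C = B * D) (h3 : A * D = B * C)
    (h : (A = 2 ∨ A = -2) ∨ (B = 2 ∨ B = -2) ∨ (C = 2 ∨ C = -2) ∨ (D = 2 ∨ D = -2)) :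
    (A = 2 ∨ A = -2) ∧ (B = 2 ∨ B = -2) ∧ (C = 2 ∨ C = -2) ∧ (D = 2 ∨ D = -2) := by
  rcases hA with (rfl | rfl) | (rfl | rfl) <;> rcases hB with (rfl | rfl) | (rfl | rfl) <;>
  rcases hC with (rfl | rfl) | (rfl | rfl) <;> omega

/-- Each block has zero or two points with label below two. -/
def TwoPoint (p : Fin 4 → Fin 6 × Fin 6 → Fin 6) : Prop :=
  ∀ x, smallCount (p 0 x) (p 1 x) (p 2 x) (p 3 x) = 0 ∨
    smallCount (p 0 x) (p 1 x) (p 2 x) (p 3 x) = 2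

theorem IsTD.relabel {p : Fin 4 → Fin 6 × Fin 6 → Fin 6} (hp : IsTD p)
    (π : Fin 4 → Equiv.Perm (Fin 6)) : IsTD fun i x => π i (p i x) := by
  intro i j hij
  exact ((π i).bijective.prodMap (π j).bijective).comp (hp i j hij)

/-- Indicator of the labels below two. -/
def lowInd (a : Fin 6) : ℤ := if a.val < 2 then 1 else 0

theorem lowInd_cases (a : Fin 6) : lowInd a = 0 ∨ lowInd a = 1 := by
  unfold lowInd; split_ifs <;> simp

theorem smallCount_eq (a b c d : Fin 6) :
    (smallCount a b c d : ℤ) = lowInd a + lowInd b + lowInd c + lowInd d := by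
  have h : ∀ a : Fin 6, ((Nat.ble a 1).toNat : ℤ) = lowInd a := by decide
  simp [smallCount, h]

theorem twoPoint_of_even {p : Fin 4 → Fin 6 × Fin 6 → Fin 6} (hp : IsTD p)
    (he : ∀ x, Even (lowInd (p 0 x) + lowInd (p 1 x) + lowInd (p 2 x) + lowInd (p 3 x))) :
    TwoPoint p := by
  have hs : ∑ a, lowInd a = 2 := by decide
  have h1 : ∀ i, ∑ x, lowInd (p i x) = 12 := fun i => by rw [hp.sum_one, hs]; norm_num
  have h2 : ∀ i j, i ≠ j → ∑ x, lowInd (p i x) * lowInd (p j x) = 4 := fun i j hij => by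
    rw [hp.sum_pair hij, hs]; norm_num
  set n : Fin 6 × Fin 6 → ℤ := fun x =>
    lowInd (p 0 x) + lowInd (p 1 x) + lowInd (p 2 x) + lowInd (p 3 x) with hn
  have hsum : ∑ x, n x * (n x - 2) = 0 := by
    have hpt : ∀ x, n x * (n x - 2) =
        2 * (lowInd (p 0 x) * lowInd (p 1 x)) + 2 * (lowInd (p 0 x) * lowInd (p 2 x)) +
        2 * (lowInd (p 0 x) * lowInd (p 3 x)) + 2 * (lowInd (p 1 x) * lowInd (p 2 x)) +
        2 * (lowInd (p 1 x) * lowInd (p 3 x)) + 2 * (lowInd (p 2 x) * lowInd (p 3 x)) -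
        lowInd (p 0 x) - lowInd (p 1 x) - lowInd (p 2 x) - lowInd (p 3 x) := by
      intro x
      have hsq : ∀ a, lowInd a * lowInd a = lowInd a := fun a => by
        rcases lowInd_cases a with h | h <;> simp [h]
      have e0 := hsq (p 0 x)
      have e1 := hsq (p 1 x)
      have e2 := hsq (p 2 x)
      have e3 := hsq (p 3 x)
      simp only [hn]
      linear_combination e0 + e1 + e2 + e3
    simp only [hpt, Finset.sum_add_distrib, Finset.sum_sub_distrib, ← Finset.mul_sum, h1]
    rw [h2 0 1 (by decide), h2 0 2 (by decide), h2 0 3 (by decide), h2 1 2 (by decide),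
      h2 1 3 (by decide), h2 2 3 (by decide)]
    norm_num
  have hcase : ∀ x, n x = 0 ∨ n x = 2 ∨ n x = 4 := by
    intro x
    obtain ⟨k, hk⟩ := he x
    have b0 := lowInd_cases (p 0 x)
    have b1 := lowInd_cases (p 1 x)
    have b2 := lowInd_cases (p 2 x)
    have b3 := lowInd_cases (p 3 x)
    simp only [hn]
    omega
  have hz := (Finset.sum_eq_zero_iff_of_nonneg (fun x _ => by
    rcases hcase x with h | h | h <;> simp [h])).1 hsum
  intro x
  have hx := hz x (Finset.mem_univ x)
  have hsc := smallCount_eq (p 0 x) (p 1 x) (p 2 x) (p 3 x)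
  change _ = n x at hsc
  rcases hcase x with h | h | h
  · left; omega
  · right; omega
  · rw [h] at hx; norm_num at hx

theorem exists_twoPoint {p : Fin 4 → Fin 6 × Fin 6 → Fin 6} (hp : IsTD p) :
    ∃ q, IsTD q ∧ TwoPoint q := by
  obtain ⟨v, hv, i₀, a₀, b₀, hne⟩ := exists_code hp
  have hev := code_even hp v hv
  have hsum := code_sum v hv
  set f : Fin 4 → Fin 6 → ℤ := fun i a => if v (i, a) = 0 then 1 else -1 with hf
  have hS := fun i => signs_total (fun a => v (i, a)) (hev i)
  have sgn : ∀ a b c d : ZMod 2, a + b + c + d = 0 →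
      ((if a = 0 then (1 : ℤ) else -1) * (if b = 0 then (1 : ℤ) else -1) =
      (if c = 0 then (1 : ℤ) else -1) * (if d = 0 then (1 : ℤ) else -1)) ∧
      ((if a = 0 then (1 : ℤ) else -1) * (if c = 0 then (1 : ℤ) else -1) =
      (if b = 0 then (1 : ℤ) else -1) * (if d = 0 then (1 : ℤ) else -1)) ∧
      ((if a = 0 then (1 : ℤ) else -1) * (if d = 0 then (1 : ℤ) else -1) =
      (if b = 0 then (1 : ℤ) else -1) * (if c = 0 then (1 : ℤ) else -1)) := by decide
  have e1 : (∑ a, f 0 a) * (∑ a, f 1 a) = (∑ a, f 2 a) * (∑ a, f 3 a) := by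
    rw [← hp.sum_pair (i := 0) (j := 1) (by decide),
      ← hp.sum_pair (i := 2) (j := 3) (by decide)]
    exact Finset.sum_congr rfl fun x _ => (sgn _ _ _ _ (hsum x)).1
  have e2 : (∑ a, f 0 a) * (∑ a, f 2 a) = (∑ a, f 1 a) * (∑ a, f 3 a) := by
    rw [← hp.sum_pair (i := 0) (j := 2) (by decide),
      ← hp.sum_pair (i := 1) (j := 3) (by decide)]
    exact Finset.sum_congr rfl fun x _ => (sgn _ _ _ _ (hsum x)).2.1
  have e3 : (∑ a, f 0 a) * (∑ a, f 3 a) = (∑ a, f 1 a) * (∑ a, f 2 a) := by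
    rw [← hp.sum_pair (i := 0) (j := 3) (by decide),
      ← hp.sum_pair (i := 1) (j := 2) (by decide)]
    exact Finset.sum_congr rfl fun x _ => (sgn _ _ _ _ (hsum x)).2.2
  have hi₀ := (hS i₀).1.1 ⟨a₀, b₀, hne⟩
  have hall := sums_two _ _ _ _ (hS 0).2 (hS 1).2 (hS 2).2 (hS 3).2 e1 e2 e3 (by
    fin_cases i₀
    · exact Or.inl hi₀
    · exact Or.inr (Or.inl hi₀)
    · exact Or.inr (Or.inr (Or.inl hi₀))
    · exact Or.inr (Or.inr (Or.inr hi₀)))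
  have hsplit : ∀ i, ∃ c x y, x ≠ y ∧ ∀ a, v (i, a) = if a = x ∨ a = y then c + 1 else c := by
    intro i
    apply even_split (fun a => v (i, a)) (hev i)
    apply (hS i).1.2
    fin_cases i
    · exact hall.1
    · exact hall.2.1
    · exact hall.2.2.1
    · exact hall.2.2.2
  choose c x y hxy hc using hsplit
  have hfs : ∀ i, ∑ a, f i a = if c i = 0 then 2 else -2 := by
    intro i
    rw [← sign_sum_pair (c i) (x i) (y i) (hxy i)]
    exact Finset.sum_congr rfl fun a _ => by simp only [hf, hc]
  have hcs : c 0 + c 1 + c 2 + c 3 = 0 := by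
    rw [hfs, hfs, hfs, hfs] at e1
    revert e1
    generalize c 0 = k0
    generalize c 1 = k1
    generalize c 2 = k2
    generalize c 3 = k3
    revert k0 k1 k2 k3
    decide
  let π : Fin 4 → Equiv.Perm (Fin 6) := fun i =>
    Equiv.swap 1 (Equiv.swap 0 (x i) (y i)) * Equiv.swap 0 (x i)
  refine ⟨fun i z => π i (p i z), hp.relabel π, twoPoint_of_even (hp.relabel π) ?_⟩
  intro z
  have hl : ∀ i a, v (i, a) = c i + ((lowInd (π i a) : ℤ) : ZMod 2) := by
    intro i a
    have := swap_pair (x i) (y i) a (hxy i)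
    rw [hc, lowInd]
    change (π i a).val < 2 ↔ _ at this
    by_cases h : a = x i ∨ a = y i
    · rw [if_pos h, if_pos (this.2 h)]; simp
    · rw [if_neg h, if_neg (mt this.1 h)]; simp
  have hz := hsum z
  simp only [hl] at hz
  rw [Int.even_iff, ← Int.dvd_iff_emod_eq_zero]
  have : ((2 : ℕ) : ℤ) ∣ _ := (ZMod.intCast_zmod_eq_zero_iff_dvd (lowInd (π 0 (p 0 z)) +
    lowInd (π 1 (p 1 z)) + lowInd (π 2 (p 2 z)) + lowInd (π 3 (p 3 z))) 2).1 (by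
      push_cast
      linear_combination hz - hcs)
  exact_mod_cast this

theorem twoPoint_lowInd {q : Fin 4 → Fin 6 × Fin 6 → Fin 6} (h : TwoPoint q) (x : Fin 6 × Fin 6) :
    lowInd (q 0 x) + lowInd (q 1 x) + lowInd (q 2 x) + lowInd (q 3 x) = 0 ∨
    lowInd (q 0 x) + lowInd (q 1 x) + lowInd (q 2 x) + lowInd (q 3 x) = 2 := by
  have := smallCount_eq (q 0 x) (q 1 x) (q 2 x) (q 3 x)
  rcases h x with h | h <;> rw [h] at this <;> omega

theorem lowInd_eq_one {a : Fin 6} : lowInd a = 1 ↔ a = 0 ∨ a = 1 := by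
  revert a; decide

theorem IsTD.ext {q : Fin 4 → Fin 6 × Fin 6 → Fin 6} (hq : IsTD q) {i j : Fin 4} (hij : i ≠ j)
    {x y : Fin 6 × Fin 6} (h1 : q i x = q i y) (h2 : q j x = q j y) : x = y :=
  (hq i j hij).1 (Prod.ext h1 h2)

theorem IsTD.exists_block {q : Fin 4 → Fin 6 × Fin 6 → Fin 6} (hq : IsTD q) {i j : Fin 4}
    (hij : i ≠ j) (a b : Fin 6) : ∃ x, q i x = a ∧ q j x = b := by
  obtain ⟨x, hx⟩ := (hq i j hij).2 (a, b)
  exact ⟨x, congrArg Prod.fst hx, congrArg Prod.snd hx⟩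

theorem block_unique {q : Fin 4 → Fin 6 × Fin 6 → Fin 6} (hq : IsTD q) {i j k l : Fin 4}
    (hij : i ≠ j) (hik : i ≠ k) (hil : i ≠ l)
    (h2 : ∀ x, lowInd (q i x) + lowInd (q j x) + lowInd (q k x) + lowInd (q l x) = 0 ∨
      lowInd (q i x) + lowInd (q j x) + lowInd (q k x) + lowInd (q l x) = 2)
    {x y : Fin 6 × Fin 6} (hxy : q i x = q i y)
    (hjx : lowInd (q j x) = 1) (hkx : lowInd (q k x) = 1)
    (hjy : lowInd (q j y) = 1) (hky : lowInd (q k y) = 1) : x = y := by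
  by_contra hne
  have hj : q j x ≠ q j y := fun h => hne (hq.ext hij hxy h)
  have hk : q k x ≠ q k y := fun h => hne (hq.ext hik hxy h)
  obtain ⟨d, hdi, hdl⟩ := hq.exists_block hil (q i x) 0
  have hl0 : lowInd (q l d) = 1 := by rw [hdl]; decide
  have hlx : lowInd (q l x) = 0 := by
    have := h2 x; have := lowInd_cases (q i x); have := lowInd_cases (q l x); omega
  have hix : lowInd (q i x) = 0 := by
    have := h2 x; have := lowInd_cases (q i x); have := lowInd_cases (q l x); omega
  have hly : lowInd (q l y) = 0 := by
    have := h2 y; have := lowInd_cases (q i y); have := lowInd_cases (q l y); omega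
  have hdx : d ≠ x := by rintro rfl; omega
  have hdy : d ≠ y := by rintro rfl; omega
  have pig : ∀ a b c : Fin 6, lowInd a = 1 → lowInd b = 1 → lowInd c = 1 → a ≠ b →
      c = a ∨ c = b := by decide
  have hid : lowInd (q i d) = 0 := by rw [hdi]; exact hix
  have hjk : lowInd (q j d) = 1 ∨ lowInd (q k d) = 1 := by
    have := h2 d; have := lowInd_cases (q j d); have := lowInd_cases (q k d); omega
  rcases hjk with h | h
  · rcases pig _ _ _ hjx hjy h hj with e | e
    · exact hdx (hq.ext hij hdi e)
    · exact hdy (hq.ext hij (hdi.trans hxy) e)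
  · rcases pig _ _ _ hkx hky h hk with e | e
    · exact hdx (hq.ext hik hdi e)
    · exact hdy (hq.ext hik (hdi.trans hxy) e)

theorem exists_label {q : Fin 4 → Fin 6 × Fin 6 → Fin 6} (hq : IsTD q) {i j k l : Fin 4}
    (hij : i ≠ j) (hik : i ≠ k) (hil : i ≠ l) (hjk : j ≠ k)
    (h2 : ∀ x, lowInd (q i x) + lowInd (q j x) + lowInd (q k x) + lowInd (q l x) = 0 ∨
      lowInd (q i x) + lowInd (q j x) + lowInd (q k x) + lowInd (q l x) = 2) :
    ∃ π : Equiv.Perm (Fin 6), π 0 = 0 ∧ π 1 = 1 ∧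
      (∀ x, q j x = 0 → q k x = 0 → π (q i x) = 2) ∧
      (∀ x, q j x = 0 → q k x = 1 → π (q i x) = 3) ∧
      (∀ x, q j x = 1 → q k x = 0 → π (q i x) = 4) ∧
      (∀ x, q j x = 1 → q k x = 1 → π (q i x) = 5) := by
  obtain ⟨A, hA1, hA2⟩ := hq.exists_block hjk 0 0
  obtain ⟨B, hB1, hB2⟩ := hq.exists_block hjk 0 1
  obtain ⟨C, hC1, hC2⟩ := hq.exists_block hjk 1 0
  obtain ⟨D, hD1, hD2⟩ := hq.exists_block hjk 1 1
  have l0 : lowInd 0 = 1 := by decide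
  have l1 : lowInd 1 = 1 := by decide
  have hu : ∀ x y, lowInd (q j x) = 1 → lowInd (q k x) = 1 → lowInd (q j y) = 1 →
      lowInd (q k y) = 1 → q i x = q i y → q j x = q j y ∧ q k x = q k y := by
    intro x y a b c d h
    have := block_unique hq hij hik hil h2 h a b c d
    subst this
    exact ⟨rfl, rfl⟩
  have hhi : ∀ x, lowInd (q j x) = 1 → lowInd (q k x) = 1 → q i x ≠ 0 ∧ q i x ≠ 1 := by
    intro x a b
    have h0 : lowInd (q i x) = 0 := by
      have := h2 x; have := lowInd_cases (q i x); have := lowInd_cases (q l x); omega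
    constructor <;> intro h <;> rw [h] at h0 <;> revert h0 <;> decide
  have jA : lowInd (q j A) = 1 := by rw [hA1]; exact l0
  have kA : lowInd (q k A) = 1 := by rw [hA2]; exact l0
  have jB : lowInd (q j B) = 1 := by rw [hB1]; exact l0
  have kB : lowInd (q k B) = 1 := by rw [hB2]; exact l1
  have jC : lowInd (q j C) = 1 := by rw [hC1]; exact l1
  have kC : lowInd (q k C) = 1 := by rw [hC2]; exact l0
  have jD : lowInd (q j D) = 1 := by rw [hD1]; exact l1
  have kD : lowInd (q k D) = 1 := by rw [hD2]; exact l1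
  have nAB : q i A ≠ q i B := fun h => by
    have := (hu A B jA kA jB kB h).2; rw [hA2, hB2] at this; revert this; decide
  have nAC : q i A ≠ q i C := fun h => by
    have := (hu A C jA kA jC kC h).1; rw [hA1, hC1] at this; revert this; decide
  have nAD : q i A ≠ q i D := fun h => by
    have := (hu A D jA kA jD kD h).1; rw [hA1, hD1] at this; revert this; decide
  have nBC : q i B ≠ q i C := fun h => by
    have := (hu B C jB kB jC kC h).1; rw [hB1, hC1] at this; revert this; decide
  have nBD : q i B ≠ q i D := fun h => by
    have := (hu B D jB kB jD kD h).1; rw [hB1, hD1] at this; revert this; decide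
  have nCD : q i C ≠ q i D := fun h => by
    have := (hu C D jC kC jD kD h).2; rw [hC2, hD2] at this; revert this; decide
  have zA := hhi A jA kA
  have zB := hhi B jB kB
  have zC := hhi C jC kC
  have zD := hhi D jD kD
  let ψ : Fin 6 → Fin 6 := ![0, 1, q i A, q i B, q i C, q i D]
  have hψ : Function.Injective ψ := by
    have n01 : (0 : Fin 6) ≠ 1 := by decide
    intro s t hst
    fin_cases s <;> fin_cases t <;> first
      | rfl
      | (exfalso
         first
          | exact n01 hst | exact n01 hst.symm
          | exact zA.1 hst | exact zA.1 hst.symm | exact zA.2 hst | exact zA.2 hst.symm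
          | exact zB.1 hst | exact zB.1 hst.symm | exact zB.2 hst | exact zB.2 hst.symm
          | exact zC.1 hst | exact zC.1 hst.symm | exact zC.2 hst | exact zC.2 hst.symm
          | exact zD.1 hst | exact zD.1 hst.symm | exact zD.2 hst | exact zD.2 hst.symm
          | exact nAB hst | exact nAB hst.symm | exact nAC hst | exact nAC hst.symm
          | exact nAD hst | exact nAD hst.symm | exact nBC hst | exact nBC hst.symm
          | exact nBD hst | exact nBD hst.symm | exact nCD hst | exact nCD hst.symm)
  let e : Equiv.Perm (Fin 6) := Equiv.ofBijective ψ (Finite.injective_iff_bijective.1 hψ)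
  refine ⟨e.symm, ?_, ?_, ?_, ?_, ?_, ?_⟩
  · rw [Equiv.symm_apply_eq]; rfl
  · rw [Equiv.symm_apply_eq]; rfl
  · intro x hx hy
    rw [hq.ext hjk (hx.trans hA1.symm) (hy.trans hA2.symm), Equiv.symm_apply_eq]; rfl
  · intro x hx hy
    rw [hq.ext hjk (hx.trans hB1.symm) (hy.trans hB2.symm), Equiv.symm_apply_eq]; rfl
  · intro x hx hy
    rw [hq.ext hjk (hx.trans hC1.symm) (hy.trans hC2.symm), Equiv.symm_apply_eq]; rfl
  · intro x hx hy
    rw [hq.ext hjk (hx.trans hD1.symm) (hy.trans hD2.symm), Equiv.symm_apply_eq]; rfl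

theorem lowInd_perm (π : Equiv.Perm (Fin 6)) (h0 : π 0 = 0) (h1 : π 1 = 1) (a : Fin 6) :
    lowInd (π a) = lowInd a := by
  have h : lowInd (π a) = 1 ↔ lowInd a = 1 := by
    rw [lowInd_eq_one, lowInd_eq_one]
    conv_lhs => rw [← h0, ← h1]
    simp only [h0, h1]
    rw [← π.injective.eq_iff (a := a) (b := 0), ← π.injective.eq_iff (a := a) (b := 1), h0, h1]
  rcases lowInd_cases a with e | e <;> rcases lowInd_cases (π a) with e' | e' <;> omega

theorem mem_freeCell (r c l m : Fin 6)
    (h : smallCount r c l m = 0 ∨ smallCount r c l m = 2) :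
    ((r : ℕ), (c : ℕ), (l : ℕ), (m : ℕ)) ∈ freeCell (r, c) := by
  simp only [freeCell, List.mem_filter, List.mem_flatMap, List.mem_map, List.mem_range]
  refine ⟨⟨l, l.2, m, m.2, rfl⟩, ?_⟩
  rcases h with h | h <;> simp [h]

theorem otherCells_lt : ∀ rc ∈ otherCells, rc.1 < 6 ∧ rc.2 < 6 := by decide

theorem no_TD (p : Fin 4 → Fin 6 × Fin 6 → Fin 6) : ¬ IsTD p := by
  intro hp
  obtain ⟨q, hq, h2⟩ := exists_twoPoint hp
  have hl := twoPoint_lowInd h2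
  obtain ⟨π0, a0, a1, a2, a3, a4, a5⟩ := exists_label hq (i := 0) (j := 2) (k := 3) (l := 1)
    (by decide) (by decide) (by decide) (by decide) (fun x => by have := hl x; omega)
  obtain ⟨π1, b0, b1, b2, b3, b4, b5⟩ := exists_label hq (i := 1) (j := 2) (k := 3) (l := 0)
    (by decide) (by decide) (by decide) (by decide) (fun x => by have := hl x; omega)
  obtain ⟨π2, c0, c1, c2, c3, c4, c5⟩ := exists_label hq (i := 2) (j := 0) (k := 1) (l := 3)
    (by decide) (by decide) (by decide) (by decide) (fun x => by have := hl x; omega)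
  obtain ⟨π3, d0, d1, d2, d3, d4, d5⟩ := exists_label hq (i := 3) (j := 0) (k := 1) (l := 2)
    (by decide) (by decide) (by decide) (by decide) (fun x => by have := hl x; omega)
  let π : Fin 4 → Equiv.Perm (Fin 6) := ![π0, π1, π2, π3]
  have hr := hq.relabel π
  set r : Fin 4 → Fin 6 × Fin 6 → Fin 6 := fun i x => π i (q i x) with hrdef
  have r0 : ∀ x, r 0 x = π0 (q 0 x) := fun _ => rfl
  have r1 : ∀ x, r 1 x = π1 (q 1 x) := fun _ => rfl
  have r2 : ∀ x, r 2 x = π2 (q 2 x) := fun _ => rfl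
  have r3 : ∀ x, r 3 x = π3 (q 3 x) := fun _ => rfl
  have hr2 : TwoPoint r := by
    apply twoPoint_of_even hr
    intro x
    rw [r0, r1, r2, r3, lowInd_perm π0 a0 a1, lowInd_perm π1 b0 b1, lowInd_perm π2 c0 c1,
      lowInd_perm π3 d0 d1]
    rcases hl x with h | h <;> rw [h] <;> decide
  let Sol : ℕ × ℕ × ℕ × ℕ → Prop := fun t =>
    ∃ x, t = ((r 0 x : ℕ), (r 1 x : ℕ), (r 2 x : ℕ), (r 3 x : ℕ))
  have hc : ∀ a b, Sol a → Sol b → compatQ a b = true := by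
    rintro _ _ ⟨x, rfl⟩ ⟨y, rfl⟩
    have key : ∀ i j k, i ≠ j → (r i x : ℕ) = r i y → (r j x : ℕ) = r j y →
        (r k x : ℕ) = r k y := by
      intro i j k hij h1 h2
      rw [hr.ext hij (Fin.ext h1) (Fin.ext h2)]
    have k1 := key 0 2 1 (by decide)
    have k2 := key 0 3 1 (by decide)
    have k3 := key 1 2 0 (by decide)
    have k4 := key 1 3 0 (by decide)
    have k5 := key 2 3 0 (by decide)
    exact compatQ_of _ _ _ _ _ _ _ _ k1 k2 k3 k4 k5
  have hcells : ∀ c ∈ fixedCells ++ otherCells.map freeCell, ∃ y ∈ c, Sol y := by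
    intro c hcm
    rcases List.mem_append.1 hcm with h | h
    · have top : ∀ s t u : Fin 6, ((∀ x, q 0 x = s → q 1 x = t → π2 (q 2 x) = u)) →
          (∀ x, q 0 x = s → q 1 x = t → π3 (q 3 x) = u) → π0 s = s → π1 t = t →
          Sol ((s : ℕ), (t : ℕ), (u : ℕ), (u : ℕ)) := by
        intro s t u h1 h2 h3 h4
        obtain ⟨x, hx, hy⟩ := hq.exists_block (i := 0) (j := 1) (by decide) s t
        refine ⟨x, ?_⟩
        rw [r0, r1, r2, r3, h1 x hx hy, h2 x hx hy, hx, hy, h3, h4]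
      have bot : ∀ s t u : Fin 6, ((∀ x, q 2 x = s → q 3 x = t → π0 (q 0 x) = u)) →
          (∀ x, q 2 x = s → q 3 x = t → π1 (q 1 x) = u) → π2 s = s → π3 t = t →
          Sol ((u : ℕ), (u : ℕ), (s : ℕ), (t : ℕ)) := by
        intro s t u h1 h2 h3 h4
        obtain ⟨x, hx, hy⟩ := hq.exists_block (i := 2) (j := 3) (by decide) s t
        refine ⟨x, ?_⟩
        rw [r0, r1, r2, r3, h1 x hx hy, h2 x hx hy, hx, hy, h3, h4]
      simp only [fixedCells, List.mem_cons, List.not_mem_nil, or_false] at h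
      rcases h with rfl | rfl | rfl | rfl | rfl | rfl | rfl | rfl
      · exact ⟨_, List.mem_singleton_self _, top 0 0 2 c2 d2 a0 b0⟩
      · exact ⟨_, List.mem_singleton_self _, top 0 1 3 c3 d3 a0 b1⟩
      · exact ⟨_, List.mem_singleton_self _, top 1 0 4 c4 d4 a1 b0⟩
      · exact ⟨_, List.mem_singleton_self _, top 1 1 5 c5 d5 a1 b1⟩
      · exact ⟨_, List.mem_singleton_self _, bot 0 0 2 a2 b2 c0 d0⟩
      · exact ⟨_, List.mem_singleton_self _, bot 0 1 3 a3 b3 c0 d1⟩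
      · exact ⟨_, List.mem_singleton_self _, bot 1 0 4 a4 b4 c1 d0⟩
      · exact ⟨_, List.mem_singleton_self _, bot 1 1 5 a5 b5 c1 d1⟩
    · obtain ⟨⟨s, t⟩, hst, rfl⟩ := List.mem_map.1 h
      obtain ⟨hs, ht⟩ := otherCells_lt _ hst
      obtain ⟨x, hx, hy⟩ := hr.exists_block (i := 0) (j := 1) (by decide) ⟨s, hs⟩ ⟨t, ht⟩
      have := mem_freeCell (r 0 x) (r 1 x) (r 2 x) (r 3 x) (hr2 x)
      refine ⟨_, ?_, x, rfl⟩
      rw [hx, hy] at this ⊢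
      exact this
  have := bsearch_sound compatQ Sol hc _ [] hcells (by simp)
  rw [bsearch_fails] at this
  exact Bool.false_ne_true this

/-- There is no pair of orthogonal Latin squares of order 6 (Euler's 36 officers problem). -/
theorem stmt10 :
    ¬ ∃ L M : Fin 6 → Fin 6 → ℕ,
      IsLatinSquare 6 L ∧ IsLatinSquare 6 M ∧ OrthogonalPair 6 L M := by
  rintro ⟨L, M, ⟨hL, hLr, hLc⟩, ⟨hM, hMr, hMc⟩, hO⟩
  let l : Fin 6 × Fin 6 → Fin 6 := fun x => ⟨L x.1 x.2 - 1, by have := hL x.1 x.2; omega⟩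
  let m : Fin 6 × Fin 6 → Fin 6 := fun x => ⟨M x.1 x.2 - 1, by have := hM x.1 x.2; omega⟩
  have hl : ∀ x y, l x = l y → L x.1 x.2 = L y.1 y.2 := by
    intro x y h
    have h' : L x.1 x.2 - 1 = L y.1 y.2 - 1 := congrArg Fin.val h
    have := hL x.1 x.2
    have := hL y.1 y.2
    omega
  have hm : ∀ x y, m x = m y → M x.1 x.2 = M y.1 y.2 := by
    intro x y h
    have h' : M x.1 x.2 - 1 = M y.1 y.2 - 1 := congrArg Fin.val h
    have := hM x.1 x.2
    have := hM y.1 y.2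
    omega
  let p : Fin 4 → Fin 6 × Fin 6 → Fin 6 := ![Prod.fst, Prod.snd, l, m]
  have q01 : ∀ x y, p 0 x = p 0 y → p 1 x = p 1 y → x = y := fun x y h1 h2 => Prod.ext h1 h2
  have q02 : ∀ x y, p 0 x = p 0 y → p 2 x = p 2 y → x = y := by
    rintro ⟨a, b⟩ ⟨a', b'⟩ h1 h2
    obtain rfl : a = a' := h1
    exact Prod.ext rfl (hLr a (hl _ _ h2))
  have q03 : ∀ x y, p 0 x = p 0 y → p 3 x = p 3 y → x = y := by
    rintro ⟨a, b⟩ ⟨a', b'⟩ h1 h2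
    obtain rfl : a = a' := h1
    exact Prod.ext rfl (hMr a (hm _ _ h2))
  have q12 : ∀ x y, p 1 x = p 1 y → p 2 x = p 2 y → x = y := by
    rintro ⟨a, b⟩ ⟨a', b'⟩ h1 h2
    obtain rfl : b = b' := h1
    exact Prod.ext (hLc b (hl _ _ h2)) rfl
  have q13 : ∀ x y, p 1 x = p 1 y → p 3 x = p 3 y → x = y := by
    rintro ⟨a, b⟩ ⟨a', b'⟩ h1 h2
    obtain rfl : b = b' := h1
    exact Prod.ext (hMc b (hm _ _ h2)) rfl
  have q23 : ∀ x y, p 2 x = p 2 y → p 3 x = p 3 y → x = y := fun x y h1 h2 =>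
    hO (Prod.ext (hl _ _ h1) (hm _ _ h2))
  refine no_TD p fun i j hij => Finite.injective_iff_bijective.1 fun x y hxy => ?_
  have h1 : p i x = p i y := congrArg Prod.fst hxy
  have h2 : p j x = p j y := congrArg Prod.snd hxy
  fin_cases i <;> fin_cases j <;> first
    | exact absurd rfl hij
    | exact q01 x y h1 h2
    | exact q01 x y h2 h1
    | exact q02 x y h1 h2
    | exact q02 x y h2 h1
    | exact q03 x y h1 h2
    | exact q03 x y h2 h1
    | exact q12 x y h1 h2
    | exact q12 x y h2 h1
    | exact q13 x y h1 h2
    | exact q13 x y h2 h1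
    | exact q23 x y h1 h2
    | exact q23 x y h2 h1
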